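/- Let $P_n$ be the (half) number of remaining cards at the first pure luck guess in the one-time riffle shuffle card guessing game with $n$ cards. Then for every real $x$ with $0 < x < 1$: $\lim_{n \to \infty} \mathbb{P}\big(P_n \le x \cdot \tfrac{n}{2}\big) = \frac{2}{\pi}\arcsin\sqrt{x}$; i.e., $P_n/(n/2)$ converges in distribution to the Arcsine ($\beta(1/2,1/2)$) law. -/

import Mathlib

/-- `h w` is the largest `k ≥ 0` such that the suffix of `w` of length `2k`
contains exactly `k` letters `a` (`true`) and `k` letters `b` (`false`). -/
def h (w : List Bool) : ℕ :=
  (Finset.range (w.length + 1)).sup fun k =>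
    if 2 * k ≤ w.length ∧ (w.drop (w.length - 2 * k)).count true = k then k else 0

/-- First-pure-luck quantity in the riffle-shuffle guessing game:
`p [] = 0`, `p (a w') = p w'`, `p (b^n) = 0`, and `p (b w') = h w'` for
`w' ≠ b^(n-1)`. -/
def p : List Bool → ℕ
  | [] => 0
  | true :: w => p w
  | false :: w => if w = List.replicate w.length false then 0 else h w

/-- `P(P_n ≤ t)`, for `P_n = p(W)` with `W` uniform on `{a,b}^n`. -/
noncomputable def PPle (n : ℕ) (t : ℝ) : ℝ :=
  ((Finset.univ.filter fun w : Fin n → Bool => (p (List.ofFn w) : ℝ) ≤ t).card : ℝ) / 2 ^ n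

/-- Balanced suffix predicate. -/
def Bal (w : List Bool) (k : ℕ) : Prop :=
  2 * k ≤ w.length ∧ (w.drop (w.length - 2 * k)).count true = k

theorem bal_zero (w : List Bool) : Bal w 0 := by simp [Bal]

theorem h_le_iff (w : List Bool) (m : ℕ) : h w ≤ m ↔ ∀ k, Bal w k → k ≤ m := by
  unfold h
  rw [Finset.sup_le_iff]
  constructor
  · intro H k hk
    have := H k (by have := hk.1; simp; omega)
    unfold Bal at hk
    rwa [if_pos hk] at this
  · intro H k _
    split_ifs with hk
    · exact H k hk
    · exact Nat.zero_le _

theorem bal_h (w : List Bool) : Bal w (h w) := by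
  unfold h
  obtain ⟨k, _, hk⟩ := Finset.exists_mem_eq_sup (Finset.range (w.length + 1)) ⟨0, by simp⟩
    (fun k => if 2 * k ≤ w.length ∧ (w.drop (w.length - 2 * k)).count true = k then k else 0)
  rw [hk]
  split_ifs with hb
  · exact hb
  · exact bal_zero w

theorem le_h {w : List Bool} {k : ℕ} (hk : Bal w k) : k ≤ h w := (h_le_iff w _).1 le_rfl k hk

theorem bal_append (w₁ w₂ : List Bool) (i j : ℕ) (h1 : w₂.length = 2 * i)
    (h2 : w₂.count true = i) : Bal (w₁ ++ w₂) (i + j) ↔ Bal w₁ j := by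
  unfold Bal
  rw [List.drop_append, List.length_append, h1, List.count_append]
  constructor
  · rintro ⟨ha, hb⟩
    have e1 : w₁.length + 2 * i - 2 * (i + j) = w₁.length - 2 * j := by omega
    have e2 : w₁.length + 2 * i - 2 * (i + j) - w₁.length = 0 := by omega
    rw [e2, e1, List.drop_zero, h2] at hb
    exact ⟨by omega, by omega⟩
  · rintro ⟨ha, hb⟩
    have e1 : w₁.length + 2 * i - 2 * (i + j) = w₁.length - 2 * j := by omega
    have e2 : w₁.length + 2 * i - 2 * (i + j) - w₁.length = 0 := by omega
    rw [e2, e1, List.drop_zero, h2]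
    exact ⟨by omega, by omega⟩

theorem h_append (w₁ w₂ : List Bool) (i : ℕ) (h1 : w₂.length = 2 * i) :
    h (w₁ ++ w₂) = i ↔ w₂.count true = i ∧ h w₁ = 0 := by
  constructor
  · intro H
    have hb := bal_h (w₁ ++ w₂)
    rw [H] at hb
    have h2 : w₂.count true = i := by
      have := hb.2
      rw [List.length_append, h1] at this
      simpa using this
    refine ⟨h2, ?_⟩
    have := le_h ((bal_append w₁ w₂ i _ h1 h2).2 (bal_h w₁))
    omega
  · rintro ⟨h2, h3⟩
    apply le_antisymm
    · rw [h_le_iff]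
      intro k hk
      by_contra hlt
      obtain ⟨j, rfl⟩ : ∃ j, k = i + j := ⟨k - i, by omega⟩
      have := le_h ((bal_append w₁ w₂ i _ h1 h2).1 hk)
      omega
    · have := (bal_append w₁ w₂ i 0 h1 h2).2 (bal_zero _)
      exact le_h this

theorem h_le_cons (c : Bool) (w : List Bool) : h w ≤ h (c :: w) := by
  apply le_h
  obtain ⟨ha, hb⟩ := bal_h w
  refine ⟨by simp; omega, ?_⟩
  have : (c :: w).length - 2 * h w = (w.length - 2 * h w) + 1 := by simp; omega
  rw [this, List.drop_succ_cons]
  exact hb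

theorem two_h_le (w : List Bool) : 2 * h w ≤ w.length := (bal_h w).1

theorem h_replicate (n : ℕ) : h (List.replicate n false) = 0 := by
  have := (bal_h (List.replicate n false)).2
  rw [List.drop_replicate, List.count_replicate] at this
  simpa using this.symm

theorem p_false (w : List Bool) : p (false :: w) = h w := by
  rw [p]
  split_ifs with hw
  · rw [hw, h_replicate]
  · rfl

/-- All words of length `n`. -/
def W : ℕ → Finset (List Bool)
  | 0 => {[]}
  | n + 1 => (W n).image (List.cons true) ∪ (W n).image (List.cons false)

theorem mem_W (n : ℕ) (l : List Bool) : l ∈ W n ↔ l.length = n := by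
  induction n generalizing l with
  | zero => simp [W]
  | succ n ih =>
    cases l with
    | nil => simp [W]
    | cons c l => cases c <;> simp [W, ih]

theorem card_W_succ (n : ℕ) (P : List Bool → Prop) [DecidablePred P] :
    ((W (n + 1)).filter P).card = ((W n).filter fun l => P (true :: l)).card
      + ((W n).filter fun l => P (false :: l)).card := by
  rw [W, Finset.filter_union, Finset.card_union_of_disjoint, Finset.filter_image,
    Finset.filter_image, Finset.card_image_of_injective _ (List.cons_injective),
    Finset.card_image_of_injective _ (List.cons_injective)]
  rw [Finset.disjoint_left]
  intro l
  simp only [Finset.mem_filter, Finset.mem_image]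
  rintro ⟨⟨a, _, rfl⟩, _⟩ ⟨⟨b, _, hb⟩, _⟩
  simp at hb

theorem card_W (n : ℕ) : (W n).card = 2 ^ n := by
  induction n with
  | zero => simp [W]
  | succ n ih =>
    have := card_W_succ n (fun _ => True)
    simp only [Finset.filter_true] at this
    rw [this, ih]; ring

theorem card_count (n k : ℕ) : ((W n).filter fun l => l.count true = k).card = n.choose k := by
  induction n generalizing k with
  | zero =>
    cases k with
    | zero => simp [W, Finset.filter_singleton]
    | succ k => simp [W, Finset.filter_singleton]
  | succ n ih =>
    rw [card_W_succ]
    cases k with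
    | zero => simp [ih]
    | succ k => simp [ih, Nat.choose_succ_succ]

theorem card_fin (n : ℕ) (P : List Bool → Prop) [DecidablePred P] :
    (Finset.univ.filter fun w : Fin n → Bool => P (List.ofFn w)).card = ((W n).filter P).card := by
  apply Finset.card_nbij (fun w => List.ofFn w)
  · intro w hw
    simp only [Finset.coe_filter, Set.mem_ofPred_eq, mem_W, Finset.mem_univ, true_and] at hw ⊢
    simpa using hw
  · intro a _ b _ hab
    exact List.ofFn_injective hab
  · intro l hl
    simp only [Finset.coe_filter, Set.mem_ofPred_eq, mem_W] at hl
    obtain ⟨rfl, hP⟩ := hl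
    exact ⟨l.get, by simpa using hP, by simp⟩

/-- Number of words of length `2m` with no nonempty balanced suffix. -/
def Z (m : ℕ) : ℕ := ((W (2 * m)).filter fun l => h l = 0).card

theorem card_h_eq (N i : ℕ) (hi : i ≤ N) :
    ((W (2 * N)).filter fun l => h l = i).card = i.centralBinom * Z (N - i) := by
  have e : i.centralBinom = ((W (2 * i)).filter fun l => l.count true = i).card := by
    rw [card_count]; rfl
  rw [e, Z, mul_comm (Finset.card _), ← Finset.card_product]
  apply Finset.card_nbij' (fun l => (l.take (2 * (N - i)), l.drop (2 * (N - i))))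
    (fun q => q.1 ++ q.2)
  · intro l hl
    simp only [Finset.coe_filter, Set.mem_ofPred_eq, mem_W, Finset.mem_coe, Finset.mem_product,
      Finset.mem_filter] at hl ⊢
    have h1 : (l.drop (2 * (N - i))).length = 2 * i := by simp; omega
    have := (h_append (l.take (2 * (N - i))) _ i h1).1 (by simpa using hl.2)
    refine ⟨⟨by simp; omega, this.2⟩, h1, this.1⟩
  · rintro ⟨a, b⟩ hl
    simp only [Finset.coe_filter, Set.mem_ofPred_eq, mem_W, Finset.mem_coe, Finset.mem_product,
      Finset.mem_filter] at hl ⊢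
    refine ⟨by simp; omega, (h_append a b i hl.2.1).2 ⟨hl.2.2, hl.1.2⟩⟩
  · intro l _
    simp
  · rintro ⟨a, b⟩ hl
    simp only [mem_W, Finset.mem_coe, Finset.mem_product, Finset.mem_filter] at hl
    simp [← hl.1.1]

theorem sum_Z (N : ℕ) : ∑ i ∈ Finset.range (N + 1), i.centralBinom * Z (N - i) = 4 ^ N := by
  have h1 : (W (2 * N)).card = ∑ i ∈ Finset.range (N + 1),
      ((W (2 * N)).filter fun l => h l = i).card := by
    apply Finset.card_eq_sum_card_fiberwise
    intro l hl
    have := two_h_le l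
    have h2 := (mem_W _ l).1 hl
    simp; omega
  rw [card_W, pow_mul] at h1
  rw [show (4 : ℕ) = 2 ^ 2 from rfl, h1]
  refine Finset.sum_congr rfl fun i hi => (card_h_eq N i ?_).symm
  simp at hi; omega

theorem sum_central (N : ℕ) :
    ∑ i ∈ Finset.range (N + 1), i.centralBinom * (N - i).centralBinom = 4 ^ N := by
  have half : ∀ n : ℕ, 2 * ∑ i ∈ Finset.range (n + 1), i * (i.centralBinom * (n - i).centralBinom)
      = n * ∑ i ∈ Finset.range (n + 1), i.centralBinom * (n - i).centralBinom := by
    intro n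
    have hr := Finset.sum_range_reflect
      (fun i => i * (i.centralBinom * (n - i).centralBinom)) (n + 1)
    rw [two_mul]
    nth_rewrite 1 [← hr]
    rw [← Finset.sum_add_distrib, Finset.mul_sum]
    refine Finset.sum_congr rfl fun i hi => ?_
    simp only [Finset.mem_range] at hi
    have e1 : n + 1 - 1 - i = n - i := by omega
    have e2 : n - (n - i) = i := by omega
    simp only [e1, e2]
    obtain ⟨j, rfl⟩ : ∃ j, n = i + j := ⟨n - i, by omega⟩
    simp only [Nat.add_sub_cancel_left]
    ring
  induction N with
  | zero => simp
  | succ n ih =>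
    have h1 := half (n + 1)
    rw [Finset.sum_range_succ'] at h1
    have h2 : ∑ i ∈ Finset.range (n + 1),
        (i + 1) * ((i + 1).centralBinom * (n + 1 - (i + 1)).centralBinom)
        = 4 * ∑ i ∈ Finset.range (n + 1), i * (i.centralBinom * (n - i).centralBinom)
          + 2 * ∑ i ∈ Finset.range (n + 1), i.centralBinom * (n - i).centralBinom := by
      rw [Finset.mul_sum, Finset.mul_sum, ← Finset.sum_add_distrib]
      refine Finset.sum_congr rfl fun i hi => ?_
      rw [← mul_assoc, Nat.succ_mul_centralBinom_succ, Nat.add_sub_add_right]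
      ring
    rw [h2] at h1
    have h3 := half n
    rw [ih] at h3 h1
    have h4 : (n + 1) * ∑ i ∈ Finset.range (n + 1 + 1),
        i.centralBinom * (n + 1 - i).centralBinom = (n + 1) * 4 ^ (n + 1) := by
      rw [← h1]
      linear_combination 4 * h3
    exact Nat.eq_of_mul_eq_mul_left (Nat.succ_pos n) h4

theorem Z_eq (m : ℕ) : Z m = m.centralBinom := by
  induction m using Nat.strong_induction_on with
  | _ m ih =>
    have h1 := sum_Z m
    rw [← sum_central m, Finset.sum_range_succ', Finset.sum_range_succ'] at h1
    have h2 : ∑ i ∈ Finset.range m, (i + 1).centralBinom * Z (m - (i + 1))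
        = ∑ i ∈ Finset.range m, (i + 1).centralBinom * (m - (i + 1)).centralBinom := by
      refine Finset.sum_congr rfl fun i hi => ?_
      simp only [Finset.mem_range] at hi
      rw [ih _ (by omega)]
    rw [h2] at h1
    simpa using h1

theorem card_h_eq' (N i : ℕ) (hi : i ≤ N) :
    ((W (2 * N)).filter fun l => h l = i).card = i.centralBinom * (N - i).centralBinom := by
  rw [card_h_eq N i hi, Z_eq]

/-- normalized central binomial. -/
noncomputable def u (k : ℕ) : ℝ := (k.centralBinom : ℝ) / 4 ^ k

/-- distribution function of `h`. -/
noncomputable def G (n : ℕ) (t : ℝ) : ℝ :=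
  (((W n).filter fun l => (h l : ℝ) ≤ t).card : ℝ) / 2 ^ n

theorem u_pos (k : ℕ) : 0 < u k := by
  have := Nat.centralBinom_pos k
  unfold u; positivity

theorem u_sum (N : ℕ) : ∑ i ∈ Finset.range (N + 1), u i * u (N - i) = 1 := by
  have h1 : ∀ i ∈ Finset.range (N + 1), u i * u (N - i)
      = ((i.centralBinom * (N - i).centralBinom : ℕ) : ℝ) / 4 ^ N := by
    intro i hi
    simp only [Finset.mem_range] at hi
    have : (4 : ℝ) ^ N = 4 ^ i * 4 ^ (N - i) := by rw [← pow_add]; congr 1; omega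
    rw [u, u, this]; push_cast; rw [div_mul_div_comm]
  rw [Finset.sum_congr rfl h1, ← Finset.sum_div, ← Nat.cast_sum, sum_central]
  push_cast
  exact div_self (by positivity)

theorem G_eq (N : ℕ) (t : ℝ) (h0 : 0 ≤ t) (h1 : t ≤ N) :
    G (2 * N) t = ∑ i ∈ Finset.range (⌊t⌋₊ + 1), u i * u (N - i) := by
  have hk : ⌊t⌋₊ ≤ N := by
    have := Nat.floor_le_floor h1
    simpa using this
  have hc : ((W (2 * N)).filter fun l => (h l : ℝ) ≤ t).card = ∑ i ∈ Finset.range (⌊t⌋₊ + 1),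
      i.centralBinom * (N - i).centralBinom := by
    rw [Finset.card_eq_sum_card_fiberwise (f := h) (t := Finset.range (⌊t⌋₊ + 1))]
    · refine Finset.sum_congr rfl fun i hi => ?_
      simp only [Finset.mem_range] at hi
      rw [← card_h_eq' N i (by omega), Finset.filter_filter]
      congr 1
      apply Finset.filter_congr
      intro l _
      constructor
      · exact fun q => q.2
      · intro q
        refine ⟨?_, q⟩
        rw [q]
        exact (Nat.le_floor_iff h0).1 (by omega)
    · intro l hl
      simp only [Finset.coe_filter, Set.mem_ofPred_eq] at hl
      have := Nat.le_floor hl.2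
      simp; omega
  rw [G, hc, Nat.cast_sum, Finset.sum_div]
  refine Finset.sum_congr rfl fun i hi => ?_
  simp only [Finset.mem_range] at hi
  have : (2 : ℝ) ^ (2 * N) = 4 ^ i * 4 ^ (N - i) := by
    rw [← pow_add, pow_mul]; norm_num; congr 1; omega
  rw [u, u, this]; push_cast; rw [div_mul_div_comm]

theorem PPle_eq (n : ℕ) (t : ℝ) :
    PPle n t = (((W n).filter fun l => (p l : ℝ) ≤ t).card : ℝ) / 2 ^ n := by
  rw [PPle, card_fin n (fun l => (p l : ℝ) ≤ t)]

theorem PPle_succ (n : ℕ) (t : ℝ) : PPle (n + 1) t = (PPle n t + G n t) / 2 := by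
  rw [PPle_eq, PPle_eq, G, card_W_succ]
  have ht : ∀ l, p (true :: l) = p l := fun l => rfl
  simp only [p_false, ht]
  push_cast
  rw [pow_succ]
  field_simp

theorem G_succ_le (n : ℕ) (t : ℝ) : G (n + 1) t ≤ G n t := by
  have H : ∀ c : Bool, ((W n).filter fun l => (h (c :: l) : ℝ) ≤ t).card ≤
      ((W n).filter fun l => (h l : ℝ) ≤ t).card := by
    intro c
    apply Finset.card_le_card
    intro l
    simp only [Finset.mem_filter]
    rintro ⟨ha, hb⟩
    exact ⟨ha, le_trans (by exact_mod_cast h_le_cons c l) hb⟩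
  rw [G, G, card_W_succ, div_le_div_iff₀ (by positivity) (by positivity), pow_succ]
  have h1 := H true
  have h2 := H false
  rify at h1 h2
  push_cast
  have : (0 : ℝ) < 2 ^ n := by positivity
  nlinarith

theorem G_anti (t : ℝ) : Antitone fun n => G n t := antitone_nat_of_succ_le fun n => G_succ_le n t

theorem G_nonneg (n : ℕ) (t : ℝ) : 0 ≤ G n t := by unfold G; positivity

theorem G_le_PPle (n : ℕ) (t : ℝ) : G n t ≤ PPle n t := by
  induction n with
  | zero =>
    rw [PPle_eq, G]
    have h1 : (W 0).filter (fun l => (h l : ℝ) ≤ t) = (W 0).filter (fun l => (p l : ℝ) ≤ t) := by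
      apply Finset.filter_congr
      intro l hl
      obtain rfl : l = [] := by simpa [W] using hl
      have e : h [] = p [] := by have := h_replicate 0; simpa [p] using this
      rw [e]
    rw [h1]
  | succ n ih =>
    rw [PPle_succ]
    have := G_succ_le n t
    linarith

theorem PPle_le_one (n : ℕ) (t : ℝ) : PPle n t ≤ 1 := by
  rw [PPle_eq]
  apply div_le_one_of_le₀ _ (by positivity)
  have := Finset.card_filter_le (W n) (fun l => (p l : ℝ) ≤ t)
  rw [card_W] at this
  exact_mod_cast this

theorem PPle_le (n J : ℕ) (t : ℝ) : PPle (n + J) t ≤ (1 / 2) ^ J + G n t := by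
  induction J with
  | zero =>
    have := PPle_le_one n t
    have := G_nonneg n t
    simp; linarith
  | succ J ih =>
    rw [← add_assoc, PPle_succ, pow_succ]
    have : G (n + J) t ≤ G n t := G_anti t (by omega)
    linarith

theorem u_sq (k : ℕ) : 1 / (Real.pi * (k + 1 / 2)) ≤ u k ^ 2 := by
  have h1 := Real.Wallis.W_le k
  have h2 : Real.Wallis.W k * (u k ^ 2 * (2 * k + 1)) = 1 := by
    rw [Real.Wallis.W_eq_factorial_ratio, u]
    have h3 : (k.centralBinom : ℝ) * (k.factorial * k.factorial) = (2 * k).factorial := by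
      have := Nat.choose_mul_factorial_mul_factorial (show k ≤ 2 * k by omega)
      rw [show 2 * k - k = k by omega] at this
      rw [← this, Nat.centralBinom]; push_cast; ring
    rw [← h3]
    have hc : (k.centralBinom : ℝ) ≠ 0 := by exact_mod_cast Nat.centralBinom_ne_zero k
    have hf : (k.factorial : ℝ) ≠ 0 := by exact_mod_cast Nat.factorial_ne_zero k
    have hk : (2 * (k : ℝ) + 1) ≠ 0 := by positivity
    have e : (2 : ℝ) ^ (4 * k) = (4 ^ k) ^ 2 := by
      rw [← pow_mul, show (4 : ℝ) = 2 ^ 2 by norm_num, ← pow_mul]; congr 1; ring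
    rw [e]
    field_simp
  have hu := u_pos k
  rw [div_le_iff₀ (by positivity)]
  have : 0 ≤ (Real.pi / 2 - Real.Wallis.W k) * (u k ^ 2 * (2 * k + 1)) :=
    mul_nonneg (by linarith) (by positivity)
  linarith

/-- Arcsine distribution function. -/
noncomputable def Th (x : ℝ) : ℝ := 2 / Real.pi * Real.arcsin (Real.sqrt x)

theorem Th_cont : Continuous Th := by
  unfold Th
  exact continuous_const.mul (Real.continuous_arcsin.comp Real.continuous_sqrt)

theorem Th_deriv (x : ℝ) (h0 : 0 < x) (h1 : x < 1) :
    HasDerivAt Th (1 / (Real.pi * Real.sqrt (x * (1 - x)))) x := by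
  have hs : Real.sqrt x < 1 := by rw [Real.sqrt_lt' one_pos]; simpa using h1
  have hs0 : 0 < Real.sqrt x := Real.sqrt_pos.2 h0
  have := ((Real.hasDerivAt_arcsin (x := Real.sqrt x) (by linarith) hs.ne).comp x
    (Real.hasDerivAt_sqrt h0.ne')).const_mul (2 / Real.pi)
  refine this.congr_deriv ?_
  rw [Real.sq_sqrt h0.le, Real.sqrt_mul h0.le]
  have : 0 < Real.sqrt (1 - x) := Real.sqrt_pos.2 (by linarith)
  have := Real.pi_pos
  field_simp

theorem step (N i : ℕ) (hi : i ≤ N) :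
    Th (((i : ℝ) + 2) / (N + 3)) - Th (((i : ℝ) + 1) / (N + 3)) ≤ u i * u (N - i) := by
  have hi' : (i : ℝ) ≤ N := by exact_mod_cast hi
  have hi0 : (0 : ℝ) ≤ i := by positivity
  have hM : (0 : ℝ) < (N : ℝ) + 3 := by positivity
  obtain ⟨c, ⟨hc1, hc2⟩, hc⟩ := exists_hasDerivAt_eq_slope Th
    (fun x => 1 / (Real.pi * Real.sqrt (x * (1 - x))))
    (a := ((i : ℝ) + 1) / (N + 3)) (b := ((i : ℝ) + 2) / (N + 3))
    (by gcongr; norm_num) Th_cont.continuousOn (by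
      intro x hx
      apply Th_deriv
      · exact lt_trans (by positivity) hx.1
      · exact lt_of_lt_of_le hx.2 (by rw [div_le_one hM]; linarith))
  rw [div_lt_iff₀ hM] at hc1
  rw [lt_div_iff₀ hM] at hc2
  have hd : ((i : ℝ) + 2) / (N + 3) - ((i : ℝ) + 1) / (N + 3) = 1 / (N + 3) := by ring
  rw [hd, eq_div_iff (by positivity)] at hc
  rw [← hc]
  have hu := u_pos i
  have hv := u_pos (N - i)
  have hc0 : 0 < c := by by_contra hneg; nlinarith
  have hc3 : 0 < 1 - c := by by_contra hneg; nlinarith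
  refine (pow_le_pow_iff_left₀ (by positivity) (by positivity) two_ne_zero).1 ?_
  have hpi := Real.pi_pos
  have hA := u_sq i
  have hB := u_sq (N - i)
  rw [Nat.cast_sub hi] at hB
  have hNi : (0 : ℝ) ≤ (N : ℝ) - i := by linarith
  calc (1 / (Real.pi * Real.sqrt (c * (1 - c))) * (1 / ((N : ℝ) + 3))) ^ 2
      = 1 / (Real.pi * (c * (N + 3))) * (1 / (Real.pi * ((N + 3) - c * (N + 3)))) := by
        have h3 : (N : ℝ) + 3 - c * (N + 3) = (1 - c) * (N + 3) := by ring
        rw [h3, mul_pow, div_pow, mul_pow, Real.sq_sqrt (by positivity)]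
        field_simp
    _ ≤ 1 / (Real.pi * (i + 1 / 2)) * (1 / (Real.pi * ((N : ℝ) - i + 1 / 2))) := by
        have h4 : (0 : ℝ) < (N + 3) - c * (N + 3) := by linarith
        have h5 : (N : ℝ) - i + 1 / 2 ≤ (N + 3) - c * (N + 3) := by linarith
        have h6 : (i : ℝ) + 1 / 2 ≤ c * (N + 3) := by linarith
        have h7 : (0 : ℝ) ≤ 1 / (Real.pi * ((N + 3) - c * (N + 3))) := by positivity
        gcongr
    _ ≤ u i ^ 2 * u (N - i) ^ 2 := by gcongr
    _ = _ := by ring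

theorem seg (N a b : ℕ) (hab : a ≤ b) (hb : b ≤ N + 1) :
    Th (((b : ℝ) + 1) / (N + 3)) - Th (((a : ℝ) + 1) / (N + 3)) ≤
      ∑ i ∈ Finset.Ico a b, u i * u (N - i) := by
  induction b, hab using Nat.le_induction with
  | base => simp
  | succ b hab ih =>
    rw [Finset.sum_Ico_succ_top hab]
    have h1 := ih (by omega)
    have h2 := step N b (by omega)
    push_cast
    rw [show (b : ℝ) + 1 + 1 = b + 2 by ring]
    linarith

theorem G_bounds (N : ℕ) (t : ℝ) (h0 : 0 ≤ t) (h1 : t ≤ N) :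
    Th (((⌊t⌋₊ : ℝ) + 2) / (N + 3)) - Th (1 / (N + 3)) ≤ G (2 * N) t ∧
    G (2 * N) t ≤ 1 - Th (((N : ℝ) + 2) / (N + 3)) + Th (((⌊t⌋₊ : ℝ) + 2) / (N + 3)) := by
  have hk : ⌊t⌋₊ ≤ N := by
    have := Nat.floor_le_floor h1
    simpa using this
  rw [G_eq N t h0 h1]
  have ha := seg N 0 (⌊t⌋₊ + 1) (by omega) (by omega)
  have hb := seg N (⌊t⌋₊ + 1) (N + 1) (by omega) (by omega)
  have hs := Finset.sum_range_add_sum_Ico (fun i => u i * u (N - i))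
    (show ⌊t⌋₊ + 1 ≤ N + 1 by omega)
  rw [u_sum] at hs
  rw [← Finset.range_eq_Ico] at ha
  push_cast at ha hb
  rw [show (⌊t⌋₊ : ℝ) + 1 + 1 = ⌊t⌋₊ + 2 by ring] at ha hb
  rw [show (N : ℝ) + 1 + 1 = N + 2 by ring] at hb
  rw [zero_add] at ha
  constructor <;> linarith

open Filter Topology in
theorem G_tendsto (x : ℝ) (hx1 : x < 1) (N : ℕ → ℕ) (t : ℕ → ℝ)
    (hN : Tendsto N atTop atTop) (ht0 : ∀ n, 0 ≤ t n)
    (ht : Tendsto (fun n => t n / N n) atTop (𝓝 x)) :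
    Tendsto (fun n => G (2 * N n) (t n)) atTop (𝓝 (Th x)) := by
  have hNR : Tendsto (fun n => (N n : ℝ)) atTop atTop := tendsto_natCast_atTop_atTop.comp hN
  have hinv : Tendsto (fun n => ((N n : ℝ))⁻¹) atTop (𝓝 0) := tendsto_inv_atTop_zero.comp hNR
  have hN3 : Tendsto (fun n => (N n : ℝ) + 3) atTop atTop := tendsto_atTop_add_const_right _ _ hNR
  have h3 : Tendsto (fun n => 1 / ((N n : ℝ) + 3)) atTop (𝓝 0) :=
    tendsto_const_nhds.div_atTop hN3
  have hpos : ∀ᶠ n in atTop, 0 < N n := hN.eventually_gt_atTop 0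
  have hle : ∀ᶠ n in atTop, t n ≤ N n := by
    filter_upwards [hpos, ht.eventually_lt_const hx1] with n hp hl
    have hp' : (0 : ℝ) < N n := by exact_mod_cast hp
    rw [div_lt_one hp'] at hl
    exact hl.le
  -- base limit
  have hb : ∀ c : ℝ, Tendsto (fun n => (t n + c) / ((N n : ℝ) + 3)) atTop (𝓝 x) := by
    intro c
    have : Tendsto (fun n => (t n / N n + c * ((N n : ℝ))⁻¹) / (1 + 3 * ((N n : ℝ))⁻¹)) atTop
        (𝓝 ((x + c * 0) / (1 + 3 * 0))) :=
      (ht.add (hinv.const_mul c)).div ((hinv.const_mul 3).const_add 1) (by norm_num)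
    simp only [mul_zero, add_zero, div_one] at this
    refine this.congr' ?_
    filter_upwards [hpos] with n hp
    have hp' : (0 : ℝ) < N n := by exact_mod_cast hp
    field_simp
  have hfl : Tendsto (fun n => ((⌊t n⌋₊ : ℝ) + 2) / ((N n : ℝ) + 3)) atTop (𝓝 x) := by
    refine tendsto_of_tendsto_of_tendsto_of_le_of_le (hb 1) (hb 2) ?_ ?_
    · intro n
      have := Nat.lt_floor_add_one (t n)
      simp only
      gcongr ?_ / _
      linarith
    · intro n
      have := Nat.floor_le (ht0 n)
      simp only
      gcongr
  have h1 : Tendsto (fun n => ((N n : ℝ) + 2) / ((N n : ℝ) + 3)) atTop (𝓝 1) := by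
    have : Tendsto (fun n => 1 - 1 / ((N n : ℝ) + 3)) atTop (𝓝 (1 - 0)) := h3.const_sub 1
    rw [sub_zero] at this
    refine this.congr fun n => ?_
    field_simp
    ring
  have hT := (Th_cont.tendsto x).comp hfl
  have hT0 := (Th_cont.tendsto 0).comp h3
  have hT1 := (Th_cont.tendsto 1).comp h1
  have e0 : Th 0 = 0 := by simp [Th]
  have e1 : Th 1 = 1 := by
    have := Real.pi_pos
    simp [Th]
  rw [e0] at hT0
  rw [e1] at hT1
  have L := hT.sub hT0
  have R := (hT1.const_sub 1).add hT
  rw [sub_zero] at L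
  rw [sub_self, zero_add] at R
  refine tendsto_of_tendsto_of_tendsto_of_le_of_le' L R ?_ ?_
  · filter_upwards [hle] with n hn
    exact (G_bounds (N n) (t n) (ht0 n) hn).1
  · filter_upwards [hle] with n hn
    exact (G_bounds (N n) (t n) (ht0 n) hn).2

open Filter Topology in
theorem main_aux (x : ℝ) (hx0 : 0 < x) (hx1 : x < 1) :
    Tendsto (fun n : ℕ => PPle n (x * ((n : ℝ) / 2))) atTop (𝓝 (Th x)) := by
  have key : ∀ N : ℕ → ℕ, Tendsto (fun n => (N n : ℝ) / n) atTop (𝓝 (1 / 2)) →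
      Tendsto (fun n => G (2 * N n) (x * ((n : ℝ) / 2))) atTop (𝓝 (Th x)) := by
    intro N hN
    apply G_tendsto x hx1
    · have : Tendsto (fun n => (N n : ℝ) / n * n) atTop atTop :=
        hN.pos_mul_atTop (by norm_num) tendsto_natCast_atTop_atTop
      rw [← tendsto_natCast_atTop_iff (R := ℝ)]
      refine this.congr' ?_
      filter_upwards [eventually_gt_atTop 0] with n hn
      have : (0 : ℝ) < n := by exact_mod_cast hn
      field_simp
    · intro n; positivity
    · have : Tendsto (fun n => (x / 2) / ((N n : ℝ) / n)) atTop (𝓝 ((x / 2) / (1 / 2))) :=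
        tendsto_const_nhds.div hN (by norm_num)
      rw [show (x / 2) / (1 / 2) = x by ring] at this
      refine this.congr' ?_
      filter_upwards [eventually_gt_atTop 0] with n hn
      have : (0 : ℝ) < n := by exact_mod_cast hn
      rw [div_div_eq_mul_div]
      ring_nf
  have hinv : Tendsto (fun n : ℕ => 1 / (n : ℝ)) atTop (𝓝 0) := tendsto_one_div_atTop_nhds_zero_nat
  have hsq : Tendsto (fun n : ℕ => 1 / Real.sqrt n) atTop (𝓝 0) :=
    tendsto_const_nhds.div_atTop (Real.tendsto_sqrt_atTop.comp tendsto_natCast_atTop_atTop)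
  have hA : Tendsto (fun n : ℕ => ((n / 2 + 1 : ℕ) : ℝ) / n) atTop (𝓝 (1 / 2)) := by
    have l1 : Tendsto (fun n : ℕ => 1 / 2 + 1 / (n : ℝ)) atTop (𝓝 (1 / 2 + 0)) :=
      hinv.const_add _
    rw [add_zero] at l1
    refine tendsto_of_tendsto_of_tendsto_of_le_of_le' tendsto_const_nhds l1 ?_ ?_
    · filter_upwards [eventually_gt_atTop 0] with n hn
      have hn' : (0 : ℝ) < n := by exact_mod_cast hn
      have : (n : ℝ) ≤ 2 * ((n / 2 + 1 : ℕ) : ℝ) := by exact_mod_cast (by omega)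
      rw [le_div_iff₀ hn']; linarith
    · filter_upwards [eventually_gt_atTop 0] with n hn
      have hn' : (0 : ℝ) < n := by exact_mod_cast hn
      have : 2 * ((n / 2 + 1 : ℕ) : ℝ) ≤ n + 2 := by exact_mod_cast (by omega)
      rw [div_le_iff₀ hn']
      field_simp
      linarith
  have hB : Tendsto (fun n : ℕ => (((n - n.sqrt) / 2 : ℕ) : ℝ) / n) atTop (𝓝 (1 / 2)) := by
    have l1 : Tendsto (fun n : ℕ => 1 / 2 - 1 / 2 * (1 / Real.sqrt n) - 1 / (n : ℝ)) atTop
        (𝓝 (1 / 2 - 1 / 2 * 0 - 0)) := ((hsq.const_mul (1 / 2)).const_sub (1 / 2)).sub hinv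
    rw [mul_zero, sub_zero, sub_zero] at l1
    refine tendsto_of_tendsto_of_tendsto_of_le_of_le' l1 tendsto_const_nhds ?_ ?_
    · filter_upwards [eventually_gt_atTop 0] with n hn
      have hn' : (0 : ℝ) < n := by exact_mod_cast hn
      have h1 : (n : ℝ) ≤ 2 * (((n - n.sqrt) / 2 : ℕ) : ℝ) + n.sqrt + 2 := by
        exact_mod_cast (by omega)
      have h2 : (n.sqrt : ℝ) ≤ Real.sqrt n := Real.nat_sqrt_le_real_sqrt
      have h3 : 1 / Real.sqrt n * n = Real.sqrt n := by
        have hs : 0 < Real.sqrt n := Real.sqrt_pos.2 hn'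
        field_simp
        exact (Real.sq_sqrt hn'.le).symm
      have h4 : 1 / (n : ℝ) * n = 1 := by field_simp
      rw [le_div_iff₀ hn']
      rw [sub_mul, sub_mul, h4, mul_assoc, h3]
      linarith
    · filter_upwards [eventually_gt_atTop 0] with n hn
      have hn' : (0 : ℝ) < n := by exact_mod_cast hn
      have : 2 * (((n - n.sqrt) / 2 : ℕ) : ℝ) ≤ n := by exact_mod_cast (by omega)
      rw [div_le_iff₀ hn']; linarith
  have hJ : Tendsto (fun n : ℕ => ((1 : ℝ) / 2) ^ (n - 2 * ((n - n.sqrt) / 2))) atTop (𝓝 0) := by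
    refine (tendsto_pow_atTop_nhds_zero_of_lt_one (by norm_num) (by norm_num)).comp ?_
    rw [tendsto_atTop]
    intro b
    filter_upwards [eventually_ge_atTop (b * b)] with n hn
    have h1 : b ≤ n.sqrt := Nat.le_sqrt.2 hn
    have h2 : n.sqrt ≤ n := Nat.sqrt_le_self n
    omega
  have U := hJ.add (key _ hB)
  rw [zero_add] at U
  refine tendsto_of_tendsto_of_tendsto_of_le_of_le (key _ hA) U ?_ ?_
  · intro n
    refine le_trans ?_ (G_le_PPle n _)
    exact G_anti _ (by omega)
  · intro n
    have := PPle_le (2 * ((n - n.sqrt) / 2)) (n - 2 * ((n - n.sqrt) / 2)) (x * ((n : ℝ) / 2))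
    rw [show 2 * ((n - n.sqrt) / 2) + (n - 2 * ((n - n.sqrt) / 2)) = n by omega] at this
    exact this

/-- Arcsine limit law for the (half) number of remaining cards at the first
pure luck guess in the one-time riffle shuffle guessing game: for `0 < x < 1`,
`P(P_n ≤ x·n/2) → (2/π) arcsin √x`, i.e. `P_n/(n/2)` converges in
distribution to the `β(1/2,1/2)` (Arcsine) law. -/
theorem stmt19 (x : ℝ) (hx0 : 0 < x) (hx1 : x < 1) :
    Filter.Tendsto (fun n : ℕ => PPle n (x * ((n : ℝ) / 2))) Filter.atTop
      (nhds (2 / Real.pi * Real.arcsin (Real.sqrt x))) := by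
  exact main_aux x hx0 hx1
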